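/- Let G be a finite pseudoreflection subgroup of GL(n,ℂ) and let θ₁,…,θₙ be a homogeneous system of parameters for G. If f : ℂⁿ → ℂ is an entire function that is G-invariant (f(σz) = f(z) for all σ ∈ G and z ∈ ℂⁿ), then there exists a unique entire function g : ℂⁿ → ℂ such that f(z) = g(θ₁(z),…,θₙ(z)) for all z ∈ ℂⁿ. -/

import Mathlib

open MvPolynomial

noncomputable section

/-- The natural action of an invertible matrix on `ℂⁿ` by matrix-vector multiplication. -/
def gAct {n : ℕ} (σ : GL (Fin n) ℂ) (z : Fin n → ℂ) : Fin n → ℂ :=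
  Matrix.mulVec (σ : Matrix (Fin n) (Fin n) ℂ) z

/-- A pseudoreflection: an element of finite order in `GL(n,ℂ)` with `rank (1 - ρ) = 1`. -/
def IsPseudoreflection {n : ℕ} (ρ : GL (Fin n) ℂ) : Prop :=
  IsOfFinOrder ρ ∧ Matrix.rank ((1 : Matrix (Fin n) (Fin n) ℂ) - (ρ : Matrix (Fin n) (Fin n) ℂ)) = 1

/-- A subgroup of `GL(n,ℂ)` is a pseudoreflection group if it is generated by the
pseudoreflections it contains. -/
def IsPseudoreflectionGroup {n : ℕ} (G : Subgroup (GL (Fin n) ℂ)) : Prop :=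
  Subgroup.closure {ρ : GL (Fin n) ℂ | ρ ∈ G ∧ IsPseudoreflection ρ} = G

/-- The action of `σ ∈ GL(n,ℂ)` on polynomials: `(σ·p)(z) = p(σ⁻¹z)`. -/
def polyAct {n : ℕ} (σ : GL (Fin n) ℂ) (p : MvPolynomial (Fin n) ℂ) : MvPolynomial (Fin n) ℂ :=
  MvPolynomial.aeval
    (fun i => ∑ j, MvPolynomial.C (((σ⁻¹ : GL (Fin n) ℂ) : Matrix (Fin n) (Fin n) ℂ) i j)
      * MvPolynomial.X j) p

/-- The polynomial map `θ : ℂⁿ → ℂⁿ` associated to a tuple of polynomials. -/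
def polyMap {n : ℕ} (θ : Fin n → MvPolynomial (Fin n) ℂ) (z : Fin n → ℂ) : Fin n → ℂ :=
  fun i => MvPolynomial.eval z (θ i)

/-! ### Complex analysis on normed spaces -/

section Analysis

open Filter Topology Metric

variable {E : Type*} [NormedAddCommGroup E] [NormedSpace ℂ E]

/-- Cauchy's estimate for the Fréchet derivative on the unit ball. -/
lemma norm_fderiv_le_two_mul_of_differentiable {F : E → ℂ} (hF : Differentiable ℂ F)
    {x : E} {C : ℝ} (hC : ∀ y ∈ ball x 1, ‖F y‖ ≤ C) : ‖fderiv ℂ F x‖ ≤ 2 * C := by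
  have h := Complex.norm_fderiv_le_div_of_mapsTo_ball (c := x) (R₁ := 1) (R₂ := 2 * C)
    hF.differentiableOn (fun y hy => ?_) one_pos
  · simpa using h
  · rw [mem_closedBall, dist_eq_norm]
    linarith [norm_sub_le (F y) (F x), hC y hy, hC x (mem_ball_self one_pos)]

/-- A limit of entire functions, uniform on every ball, is entire. -/
lemma differentiable_of_tendstoUniformlyOn_ball {F : ℕ → E → ℂ} {g : E → ℂ}
    (hF : ∀ m, Differentiable ℂ (F m))
    (h : ∀ R : ℝ, TendstoUniformlyOn F g atTop (ball 0 R)) : Differentiable ℂ g := by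
  have hcauchy (R : ℝ) : UniformCauchySeqOn (fun m => fderiv ℂ (F m)) atTop (ball 0 R) := by
    rw [Metric.uniformCauchySeqOn_iff]
    intro ε hε
    obtain ⟨N, hN⟩ := Metric.uniformCauchySeqOn_iff.1 (h (R + 1)).uniformCauchySeqOn (ε / 4)
      (by positivity)
    refine ⟨N, fun m hm k hk x hx => ?_⟩
    have hd : fderiv ℂ (F m) x - fderiv ℂ (F k) x = fderiv ℂ (F m - F k) x :=
      (fderiv_sub (hF m x) (hF k x)).symm
    rw [dist_eq_norm, hd]
    have := norm_fderiv_le_two_mul_of_differentiable ((hF m).sub (hF k)) (x := x) (C := ε / 4)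
      (fun y hy => ?_)
    · linarith
    · have hy' : y ∈ ball (0 : E) (R + 1) := by
        rw [mem_ball] at *
        linarith [dist_triangle y x 0]
      have := hN m hm k hk y hy'
      rw [dist_eq_norm] at this
      exact this.le
  have hlim (x : E) : ∃ L, Tendsto (fun m => fderiv ℂ (F m) x) atTop (𝓝 L) :=
    cauchySeq_tendsto_of_complete
      ((hcauchy (‖x‖ + 1)).cauchySeq (by simp : x ∈ ball (0 : E) (‖x‖ + 1)))
  choose g' hg' using hlim
  intro x
  have hx : x ∈ ball (0 : E) (‖x‖ + 1) := by simp
  exact (hasFDerivAt_of_tendstoUniformlyOn isOpen_ball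
    ((hcauchy (‖x‖ + 1)).tendstoUniformlyOn_of_tendsto fun y _ => hg' y)
    (fun m y _ => (hF m y).hasFDerivAt)
    (fun y hy => (h (‖x‖ + 1)).tendsto_at hy) hx).differentiableAt

/-- A quadratic remainder estimate for the first order Taylor expansion of an entire function. -/
lemma norm_sub_sub_fderiv_le {F : E → ℂ} (hF : Differentiable ℂ F) {x v : E} {C : ℝ}
    (hC : ∀ y ∈ ball x 1, ‖F y‖ ≤ C) (hv : ‖v‖ < 1) :
    ‖F (x + v) - F x - fderiv ℂ F x v‖ ≤ 4 * C * ‖v‖ ^ 2 := by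
  have hL := norm_fderiv_le_two_mul_of_differentiable hF hC
  set L := fderiv ℂ F x with hLdef
  have key := Complex.dist_le_mul_div_pow_of_mapsTo_ball_of_isLittleO
    (f := fun y => F y - L (y - x)) (c := x) (z := x + v) (R₁ := 1) (R₂ := 4 * C) (n := 1)
    (by fun_prop) (fun y hy => ?_) ?_ (by simpa using hv)
  · simp only [dist_eq_norm, add_sub_cancel_left, sub_self, map_zero, sub_zero, div_one] at key
    rwa [sub_right_comm] at key
  · rw [mem_closedBall, dist_eq_norm]
    have h1 := hC y hy
    have h2 := hC x (mem_ball_self one_pos)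
    have hy1 : ‖y - x‖ ≤ 1 := by
      rw [mem_ball, dist_eq_norm] at hy
      exact hy.le
    have h3 : ‖L (y - x)‖ ≤ 2 * C :=
      (L.le_opNorm _).trans ((mul_le_of_le_one_right (norm_nonneg _) hy1).trans hL)
    simp only [sub_self, map_zero, sub_zero]
    linarith [norm_sub_le (F y - L (y - x)) (F x), norm_sub_le (F y) (L (y - x))]
  · have := (hF x).hasFDerivAt.isLittleO
    simp only [sub_self, map_zero, sub_zero, pow_one]
    refine (this.norm_right).congr_left fun y => ?_
    rw [← hLdef]
    ring

/-- Directional derivatives of an entire function on a finite-dimensional space are entire. -/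
lemma Differentiable.fderiv_apply_const [ProperSpace E] {F : E → ℂ} (hF : Differentiable ℂ F)
    (v : E) : Differentiable ℂ fun x => fderiv ℂ F x v := by
  refine differentiable_of_tendstoUniformlyOn_ball
    (F := fun (m : ℕ) x => (m : ℂ) * (F (x + (m : ℂ)⁻¹ • v) - F x)) (fun m => by fun_prop)
    fun R => ?_
  obtain ⟨C, hC⟩ := (isCompact_closedBall (0 : E) (R + 1)).exists_bound_of_continuousOn
    hF.continuous.continuousOn
  rw [Metric.tendstoUniformlyOn_iff]
  intro ε hε
  have h1 : ∀ᶠ m : ℕ in atTop, 4 * C * ‖v‖ ^ 2 * (m : ℝ)⁻¹ < ε := by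
    have : Tendsto (fun m : ℕ => 4 * C * ‖v‖ ^ 2 * (m : ℝ)⁻¹) atTop
        (𝓝 (4 * C * ‖v‖ ^ 2 * 0)) := tendsto_inv_atTop_nhds_zero_nat.const_mul _
    rw [mul_zero] at this
    exact this.eventually_lt_const hε
  have h2 : ∀ᶠ m : ℕ in atTop, (m : ℝ)⁻¹ * ‖v‖ < 1 := by
    have : Tendsto (fun m : ℕ => (m : ℝ)⁻¹ * ‖v‖) atTop (𝓝 (0 * ‖v‖)) :=
      tendsto_inv_atTop_nhds_zero_nat.mul_const _
    rw [zero_mul] at this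
    exact this.eventually_lt_const one_pos
  filter_upwards [h1, h2, eventually_gt_atTop 0] with m hm1 hm2 hm0 x hx
  have hmR : (0 : ℝ) < m := by exact_mod_cast hm0
  have hmC : (m : ℂ) ≠ 0 := by exact_mod_cast hm0.ne'
  have hn : ‖(m : ℂ)⁻¹ • v‖ = (m : ℝ)⁻¹ * ‖v‖ := by simp [norm_smul]
  have hb := norm_sub_sub_fderiv_le hF (x := x) (v := (m : ℂ)⁻¹ • v) (C := C)
    (fun y hy => hC y (by
      rw [mem_closedBall]
      rw [mem_ball] at hx hy
      linarith [dist_triangle y x 0])) (by rwa [hn])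
  rw [hn] at hb
  rw [dist_comm, dist_eq_norm]
  have heq : (m : ℂ) * (F (x + (m : ℂ)⁻¹ • v) - F x) - fderiv ℂ F x v
      = m * (F (x + (m : ℂ)⁻¹ • v) - F x - fderiv ℂ F x ((m : ℂ)⁻¹ • v)) := by
    rw [map_smul, smul_eq_mul]
    field_simp
  rw [heq, norm_mul, Complex.norm_natCast]
  calc (m : ℝ) * _ ≤ m * (4 * C * ((m : ℝ)⁻¹ * ‖v‖) ^ 2) := by gcongr
    _ = 4 * C * ‖v‖ ^ 2 * (m : ℝ)⁻¹ := by field_simp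
    _ < ε := hm1

end Analysis

/-! ### Polynomial approximation of entire functions -/

section Approximation

open Filter Topology Metric

variable {n : ℕ}

/-- The Taylor coefficients at the origin of an entire function along the line spanned by `z`
depend polynomially on `z`. -/
lemma exists_eval_eq_iteratedDeriv_line (k : ℕ) :
    ∀ F : (Fin n → ℂ) → ℂ, Differentiable ℂ F → ∃ p : MvPolynomial (Fin n) ℂ,
      ∀ z, iteratedDeriv k (fun t : ℂ => F (t • z)) 0 = eval z p := by
  induction k with
  | zero => exact fun F _ => ⟨C (F 0), fun z => by simp⟩
  | succ k ih =>
    intro F hF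
    choose p hp using fun i : Fin n => ih _ (hF.fderiv_apply_const (Pi.single i 1))
    refine ⟨∑ i, X i * p i, fun z => ?_⟩
    have hderiv : deriv (fun t : ℂ => F (t • z))
        = fun t => ∑ i, z i * fderiv ℂ F (t • z) (Pi.single i 1) := by
      funext t
      have h1 : HasDerivAt (fun t : ℂ => t • z) z t := by
        simpa using (hasDerivAt_id t).smul_const z
      have h2 := (hF (t • z)).hasFDerivAt.comp_hasDerivAt t h1
      refine h2.deriv.trans ?_
      exact (DFunLike.congr_arg (fderiv ℂ F (t • z)) (pi_eq_sum_univ' z)).trans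
        (by simp [map_sum])
    have hsmooth (i : Fin n) :
        ContDiff ℂ k fun t : ℂ => fderiv ℂ F (t • z) (Pi.single i 1) :=
      ((hF.fderiv_apply_const (Pi.single i 1)).comp
        (differentiable_id.smul_const z : Differentiable ℂ fun t : ℂ => t • z)).contDiff
    rw [iteratedDeriv_succ', hderiv,
      iteratedDeriv_fun_sum fun i _ => (contDiff_const.mul (hsmooth i)).contDiffAt]
    simp only [map_sum, map_mul, eval_X]
    refine Finset.sum_congr rfl fun i _ => ?_
    rw [iteratedDeriv_const_mul_field, hp]

/-- Entire functions are limits of polynomials, uniformly on every ball. -/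
lemma Differentiable.exists_mvPolynomial_tendstoUniformlyOn {F : (Fin n → ℂ) → ℂ}
    (hF : Differentiable ℂ F) : ∃ p : ℕ → MvPolynomial (Fin n) ℂ,
      ∀ R : ℝ, TendstoUniformlyOn (fun m z => eval z (p m)) F atTop (ball 0 R) := by
  choose q hq using fun k => exists_eval_eq_iteratedDeriv_line k F hF
  refine ⟨fun m => ∑ k ∈ Finset.range m, C ((k.factorial : ℂ)⁻¹) * q k, fun R => ?_⟩
  have hline (z : Fin n → ℂ) : Differentiable ℂ fun t : ℂ => F (t • z) := by fun_prop
  obtain ⟨M, hM⟩ := (isCompact_closedBall (0 : Fin n → ℂ) (2 * R)).exists_bound_of_continuousOn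
    hF.continuous.continuousOn
  have hbound (k : ℕ) (z : Fin n → ℂ) (hz : z ∈ ball 0 R) :
      ‖(k.factorial : ℂ)⁻¹ * eval z (q k)‖ ≤ M * (1 / 2) ^ k := by
    have h := Complex.norm_iteratedDeriv_le_of_forall_mem_sphere_norm_le (c := 0) (R := 2) (C := M)
      k two_pos (hline z).diffContOnCl (fun t ht => hM _ ?_)
    · rw [← hq, norm_mul, norm_inv, Complex.norm_natCast]
      have hk : (0 : ℝ) < k.factorial := by positivity
      calc _ ≤ (k.factorial : ℝ)⁻¹ * (k.factorial * M / 2 ^ k) := by gcongr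
        _ = M * (1 / 2) ^ k := by
          rw [one_div, inv_pow]
          field_simp
    · rw [mem_sphere_zero_iff_norm] at ht
      rw [mem_ball_zero_iff] at hz
      rw [mem_closedBall_zero_iff, norm_smul, ht]
      gcongr
  have hsum := tendstoUniformlyOn_tsum_nat
    (summable_geometric_two.mul_left M) hbound
  refine (hsum.congr (Eventually.of_forall fun m z _ => ?_)).congr_right fun z _ => ?_
  · simp
  · have := Complex.taylorSeries_eq_of_entire' (c := 0) (z := 1) (hline z)
    simpa [hq] using this

end Approximation

/-! ### The polynomial map given by generators of the invariants -/

section Invariants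

open Metric

variable {n : ℕ}

lemma eval_polyAct (σ : GL (Fin n) ℂ) (p : MvPolynomial (Fin n) ℂ) (z : Fin n → ℂ) :
    eval z (polyAct σ p) = eval (gAct σ⁻¹ z) p := by
  rw [polyAct, aeval_def, ← coe_eval₂Hom, ← RingHom.comp_apply]
  congr 1
  ext i <;> simp [gAct, Matrix.mulVec, dotProduct]

lemma gAct_mul (σ τ : GL (Fin n) ℂ) (z : Fin n → ℂ) :
    gAct (σ * τ) z = gAct σ (gAct τ z) := by
  simp [gAct]

lemma polyAct_mul (σ τ : GL (Fin n) ℂ) (p : MvPolynomial (Fin n) ℂ) :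
    polyAct (σ * τ) p = polyAct σ (polyAct τ p) := by
  refine MvPolynomial.funext fun z => ?_
  simp only [eval_polyAct, mul_inv_rev, gAct_mul]

/-- `polyAct σ` as an algebra homomorphism. -/
def polyActHom (σ : GL (Fin n) ℂ) : MvPolynomial (Fin n) ℂ →ₐ[ℂ] MvPolynomial (Fin n) ℂ :=
  aeval fun i => ∑ j, C (((σ⁻¹ : GL (Fin n) ℂ) : Matrix (Fin n) (Fin n) ℂ) i j) * X j

lemma polyActHom_apply (σ : GL (Fin n) ℂ) (p : MvPolynomial (Fin n) ℂ) :
    polyActHom σ p = polyAct σ p := rfl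

/-- The sum of the translates of a polynomial under a finite group is invariant. -/
lemma polyAct_sum_polyAct (G : Subgroup (GL (Fin n) ℂ)) [Fintype G] (c : ℂ)
    (p : MvPolynomial (Fin n) ℂ) {σ : GL (Fin n) ℂ} (hσ : σ ∈ G) :
    polyAct σ (C c * ∑ τ : G, polyAct (τ : GL (Fin n) ℂ) p)
      = C c * ∑ τ : G, polyAct (τ : GL (Fin n) ℂ) p := by
  rw [← polyActHom_apply, map_mul, map_sum, ← algebraMap_eq, AlgHom.commutes]
  refine congrArg (_ * ·) ?_
  simp only [polyActHom_apply, ← polyAct_mul]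
  exact Equiv.sum_comp (Equiv.mulLeft (⟨σ, hσ⟩ : G)) fun τ : G => polyAct (τ : GL (Fin n) ℂ) p

/-- If the invariants of a finite group lie in `ℂ[θ]`, then `ℂ[z]` is integral over `ℂ[θ]`. -/
lemma isIntegral_aeval_of_invariants (G : Subgroup (GL (Fin n) ℂ)) [Finite G]
    {θ : Fin n → MvPolynomial (Fin n) ℂ}
    (hθ : ∀ p : MvPolynomial (Fin n) ℂ,
      (∀ σ ∈ G, polyAct σ p = p) → p ∈ Algebra.adjoin ℂ (Set.range θ)) :
    (aeval θ : MvPolynomial (Fin n) ℂ →ₐ[ℂ] _).toRingHom.IsIntegral := by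
  have := Fintype.ofFinite G
  intro b
  let Q : Polynomial (MvPolynomial (Fin n) ℂ) :=
    ∏ σ : G, (Polynomial.X - Polynomial.C (polyAct (σ : GL (Fin n) ℂ) b))
  have hQ : Q.Monic := Polynomial.monic_prod_of_monic _ _ fun σ _ => Polynomial.monic_X_sub_C _
  have hinv (σ : GL (Fin n) ℂ) (hσ : σ ∈ G) : Q.map (polyActHom σ).toRingHom = Q := by
    simp only [Q, Polynomial.map_prod, Polynomial.map_sub, Polynomial.map_X, Polynomial.map_C]
    refine Fintype.prod_equiv (Equiv.mulLeft (⟨σ, hσ⟩ : G)) _ _ fun τ => ?_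
    simp [polyActHom_apply, polyAct_mul]
  have hlift : Q ∈ Polynomial.lifts (aeval θ : MvPolynomial (Fin n) ℂ →ₐ[ℂ] _).toRingHom := by
    rw [Polynomial.lifts_iff_coeff_lifts]
    intro k
    have : Q.coeff k ∈ Algebra.adjoin ℂ (Set.range θ) := by
      refine hθ _ fun σ hσ => ?_
      conv_rhs => rw [← hinv σ hσ]
      rw [Polynomial.coeff_map]
      rfl
    rw [Algebra.adjoin_range_eq_range_aeval] at this
    exact this
  obtain ⟨P, hP, -, hPm⟩ := Polynomial.lifts_and_degree_eq_and_monic hlift hQ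
  refine ⟨P, hPm, ?_⟩
  rw [Polynomial.eval₂_eq_eval_map, hP, Polynomial.eval_prod]
  refine Finset.prod_eq_zero (Finset.mem_univ 1) ?_
  have : polyAct (1 : GL (Fin n) ℂ) b = b :=
    MvPolynomial.funext fun z => by simp [eval_polyAct, gAct]
  simp [this]

lemma eval_aeval_eq (θ : Fin n → MvPolynomial (Fin n) ℂ) (p : MvPolynomial (Fin n) ℂ)
    (z : Fin n → ℂ) : eval z (aeval θ p) = eval (polyMap θ z) p := by
  rw [aeval_def, ← coe_eval₂Hom, ← RingHom.comp_apply]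
  congr 1
  ext i <;> simp [polyMap]

/-- If `ℂ[z]` is integral over `ℂ[θ]` and `θ` is algebraically independent, then `θ` is
surjective. -/
lemma polyMap_surjective {θ : Fin n → MvPolynomial (Fin n) ℂ} (hθ : AlgebraicIndependent ℂ θ)
    (hint : (aeval θ : MvPolynomial (Fin n) ℂ →ₐ[ℂ] _).toRingHom.IsIntegral) :
    Function.Surjective (polyMap θ) := by
  intro w
  let P : PrimeSpectrum (MvPolynomial (Fin n) ℂ) :=
    ⟨RingHom.ker (eval w : MvPolynomial (Fin n) ℂ →+* ℂ), RingHom.ker_isPrime _⟩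
  obtain ⟨Q, hQ⟩ := hint.comap_surjective hθ P
  obtain ⟨M, hM, hQM⟩ := Ideal.exists_le_maximal Q.asIdeal Q.isPrime.ne_top
  obtain ⟨x, rfl⟩ := isMaximal_iff_eq_vanishingIdeal_singleton.1 hM
  refine ⟨x, funext fun i => ?_⟩
  have h1 : (X i - C (w i) : MvPolynomial (Fin n) ℂ) ∈ P.asIdeal := by
    simp [P, RingHom.mem_ker]
  rw [← hQ] at h1
  have h2 := hQM (Ideal.mem_comap.1 h1)
  rw [mem_vanishingIdeal_singleton_iff] at h2
  simpa [sub_eq_zero, polyMap] using h2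

/-- If `ℂ[z]` is integral over `ℂ[θ]`, then `θ` is proper: preimages of balls are bounded. -/
lemma exists_norm_lt_of_polyMap_mem_ball {θ : Fin n → MvPolynomial (Fin n) ℂ}
    (hint : (aeval θ : MvPolynomial (Fin n) ℂ →ₐ[ℂ] _).toRingHom.IsIntegral) (R : ℝ) :
    ∃ R' : ℝ, ∀ z, polyMap θ z ∈ ball 0 R → z ∈ ball 0 R' := by
  choose P hPm hP using fun i : Fin n => hint (X i)
  have hcoeff (i : Fin n) (k : ℕ) :
      ∃ B : ℝ, ∀ w ∈ closedBall (0 : Fin n → ℂ) R, ‖eval w ((P i).coeff k)‖ ≤ B :=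
    (isCompact_closedBall 0 R).exists_bound_of_continuousOn
      (MvPolynomial.continuous_eval _).continuousOn
  choose B hB using hcoeff
  let T (i : Fin n) : ℝ := ∑ k ∈ Finset.range (P i).natDegree, |B i k| + 1
  have hT (i : Fin n) : 0 < T i := by positivity
  refine ⟨∑ i, T i + 1, fun z hz => ?_⟩
  rw [mem_ball_zero_iff]
  refine (pi_norm_lt_iff (by have := fun i => (hT i).le; positivity)).2 fun i => ?_
  have hroot : ((P i).map (eval (polyMap θ z))).IsRoot (z i) := by
    have h := congrArg (eval z) (hP i)
    rw [map_zero, Polynomial.eval₂_eq_sum_range, map_sum] at h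
    rw [Polynomial.IsRoot.def, Polynomial.eval_map, Polynomial.eval₂_eq_sum_range, ← h]
    refine Finset.sum_congr rfl fun k _ => ?_
    simp only [map_mul, map_pow, eval_X]
    exact congrArg (· * _) (eval_aeval_eq θ _ z).symm
  have hmonic := (hPm i).map (eval (polyMap θ z))
  have hlt := hroot.norm_lt_cauchyBound hmonic.ne_zero
  have hle : (((P i).map (eval (polyMap θ z))).cauchyBound : ℝ) ≤ T i := by
    rw [Polynomial.cauchyBound, hmonic.leadingCoeff, (hPm i).natDegree_map]
    simp only [nnnorm_one, div_one, NNReal.coe_add, NNReal.coe_one, T]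
    gcongr
    have : (Finset.range (P i).natDegree).sup
        (fun k => ‖((P i).map (eval (polyMap θ z))).coeff k‖₊)
          ≤ ∑ k ∈ Finset.range (P i).natDegree, ‖B i k‖₊ := by
      refine Finset.sup_le fun k hk => ?_
      refine le_trans ?_ (Finset.single_le_sum (f := fun k => ‖B i k‖₊) (by simp) hk)
      rw [Polynomial.coeff_map]
      exact (hB i k _ (ball_subset_closedBall hz)).trans (le_abs_self _)
    exact (NNReal.coe_le_coe.2 this).trans_eq (by simp)
  have hsingle : T i ≤ ∑ i, T i :=
    Finset.single_le_sum (fun j _ => (hT j).le) (Finset.mem_univ i)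
  linarith

end Invariants

section Averaging

open Filter Topology Metric

variable {n : ℕ}

/-- Invariant entire functions are limits of invariant polynomials, uniformly on every ball. -/
lemma exists_invariant_mvPolynomial_tendstoUniformlyOn (G : Subgroup (GL (Fin n) ℂ)) [Finite G]
    {f : (Fin n → ℂ) → ℂ} (hf : Differentiable ℂ f)
    (hfinv : ∀ σ ∈ G, ∀ z : Fin n → ℂ, f (gAct σ z) = f z) :
    ∃ p : ℕ → MvPolynomial (Fin n) ℂ, (∀ m, ∀ σ ∈ G, polyAct σ (p m) = p m) ∧
      ∀ R : ℝ, TendstoUniformlyOn (fun m z => eval z (p m)) f atTop (ball 0 R) := by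
  have := Fintype.ofFinite G
  obtain ⟨p, hp⟩ := hf.exists_mvPolynomial_tendstoUniformlyOn
  refine ⟨fun m => C (Fintype.card G : ℂ)⁻¹ * ∑ τ : G, polyAct (τ : GL (Fin n) ℂ) (p m),
    fun m σ hσ => polyAct_sum_polyAct G _ _ hσ, fun R => ?_⟩
  have hbdd (τ : G) : ∃ R' : ℝ, ∀ z ∈ ball (0 : Fin n → ℂ) R,
      gAct (τ : GL (Fin n) ℂ)⁻¹ z ∈ ball (0 : Fin n → ℂ) R' := by
    have hcont : Continuous (gAct (τ : GL (Fin n) ℂ)⁻¹) := by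
      unfold gAct
      fun_prop
    obtain ⟨B, hB⟩ := (isCompact_closedBall (0 : Fin n → ℂ) R).exists_bound_of_continuousOn
      hcont.continuousOn
    exact ⟨B + 1, fun z hz => mem_ball_zero_iff.2
      ((hB z (ball_subset_closedBall hz)).trans_lt (lt_add_one B))⟩
  choose R' hR' using hbdd
  rw [Metric.tendstoUniformlyOn_iff]
  intro ε hε
  have hev : ∀ᶠ m in atTop, ∀ τ : G, ∀ z ∈ ball (0 : Fin n → ℂ) (R' τ),
      dist (f z) (eval z (p m)) < ε :=
    eventually_all.2 fun τ => Metric.tendstoUniformlyOn_iff.1 (hp (R' τ)) ε hε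
  filter_upwards [hev] with m hm z hz
  have hcard : (0 : ℝ) < Fintype.card G := by exact_mod_cast Fintype.card_pos
  have hcard' : (Fintype.card G : ℂ) ≠ 0 := by exact_mod_cast Fintype.card_ne_zero
  have heq : f z - eval z (C (Fintype.card G : ℂ)⁻¹ * ∑ τ : G, polyAct (τ : GL (Fin n) ℂ) (p m))
      = (Fintype.card G : ℂ)⁻¹ * ∑ τ : G, (f (gAct (τ : GL (Fin n) ℂ)⁻¹ z)
        - eval (gAct (τ : GL (Fin n) ℂ)⁻¹ z) (p m)) := by
    simp only [hfinv _ (inv_mem (SetLike.coe_mem _)), Finset.sum_sub_distrib, map_mul, map_sum,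
      eval_polyAct, eval_C, Finset.sum_const, Finset.card_univ, nsmul_eq_mul, mul_sub]
    rw [inv_mul_cancel_left₀ hcard']
  rw [dist_eq_norm, heq, norm_mul, norm_inv, Complex.norm_natCast, inv_mul_lt_iff₀ hcard]
  calc _ ≤ ∑ τ : G, ‖f (gAct (τ : GL (Fin n) ℂ)⁻¹ z)
        - eval (gAct (τ : GL (Fin n) ℂ)⁻¹ z) (p m)‖ := norm_sum_le _ _
    _ < ∑ _τ : G, ε := Finset.sum_lt_sum_of_nonempty Finset.univ_nonempty fun τ _ => by
        simpa [dist_eq_norm] using hm τ _ (hR' τ z hz)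
    _ = Fintype.card G * ε := by simp

end Averaging

/-- **Analytic Chevalley–Shephard–Todd theorem (invariant form).**
If `G` is a finite pseudoreflection subgroup of `GL(n,ℂ)` with homogeneous system of
parameters `θ₁,…,θₙ`, then every `G`-invariant entire function `f : ℂⁿ → ℂ` factors
uniquely as `f = g ∘ θ` with `g` entire. -/
theorem analytic_CST_invariant {n : ℕ} (G : Subgroup (GL (Fin n) ℂ)) [Finite G]
    (hG : IsPseudoreflectionGroup G)
    (θ : Fin n → MvPolynomial (Fin n) ℂ) (dd : Fin n → ℕ)
    (hθhom : ∀ i, (θ i).IsHomogeneous (dd i))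
    (hθalg : AlgebraicIndependent ℂ θ)
    (hθgen : ∀ p : MvPolynomial (Fin n) ℂ,
      (∀ σ ∈ G, polyAct σ p = p) ↔ p ∈ Algebra.adjoin ℂ (Set.range θ))
    (f : (Fin n → ℂ) → ℂ) (hf : Differentiable ℂ f)
    (hfinv : ∀ σ ∈ G, ∀ z : Fin n → ℂ, f (gAct σ z) = f z) :
    ∃! g : (Fin n → ℂ) → ℂ, Differentiable ℂ g ∧ ∀ z : Fin n → ℂ, f z = g (polyMap θ z) := by
  have hint := isIntegral_aeval_of_invariants G fun p => (hθgen p).1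
  have hsurj := polyMap_surjective hθalg hint
  choose s hs using hsurj
  obtain ⟨p, hpinv, hp⟩ := exists_invariant_mvPolynomial_tendstoUniformlyOn G hf hfinv
  have hq (m : ℕ) : ∃ q : MvPolynomial (Fin n) ℂ, aeval θ q = p m := by
    have := (hθgen (p m)).1 (hpinv m)
    rwa [Algebra.adjoin_range_eq_range_aeval] at this
  choose q hq using hq
  have hpq (m : ℕ) (z : Fin n → ℂ) : eval z (p m) = eval (polyMap θ z) (q m) := by
    rw [← hq, eval_aeval_eq]
  have hlim (z : Fin n → ℂ) :
      Filter.Tendsto (fun m => eval (polyMap θ z) (q m)) Filter.atTop (nhds (f z)) := by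
    simpa only [hpq] using (hp (‖z‖ + 1)).tendsto_at (by simp : z ∈ Metric.ball 0 (‖z‖ + 1))
  refine ⟨f ∘ s, ⟨?_, fun z => ?_⟩, fun g hg => funext fun w => ?_⟩
  · refine differentiable_of_tendstoUniformlyOn_ball (F := fun m w => eval w (q m))
      (fun m => ?_) fun R => ?_
    · exact differentiableOn_univ.1 (AnalyticOnNhd.eval_mvPolynomial (𝕜 := ℂ) (q m)).differentiableOn
    · obtain ⟨R', hR'⟩ := exists_norm_lt_of_polyMap_mem_ball hint R
      refine (((hp R').comp s).mono fun w hw => hR' _ (by rwa [hs])).congr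
        (Filter.Eventually.of_forall fun m w _ => ?_)
      simp only [Function.comp_apply, hpq, hs]
  · have h := hlim (s (polyMap θ z))
    rw [hs] at h
    exact tendsto_nhds_unique (hlim z) h
  · have := hg.2 (s w)
    rw [hs] at this
    exact this.symm
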